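/- Let K be a field and Λ a balanced block. In the Blanchet–Khovanov algebra A^F_Λ, the elements 1_λ = underline λ λ overline λ for λ ∈ Λ° satisfy: mult(1_λ ⊗ 1_λ) = 1_λ; mult(1_λ ⊗ 1_μ) = 0 for λ ≠ μ; and for every basis vector x = underline λ ν overline μ one has mult(1_λ ⊗ x) = x = mult(x ⊗ 1_μ). Hence the 1_λ are pairwise orthogonal idempotents and 1 = Σ_{λ∈Λ°} 1_λ is a unit for A^F_Λ. -/

import Mathlib

namespace BK

/-- The symbols `∘, ×, ∨, ∧` labelling the integral positions of a weight. -/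
inductive Symb : Type
  | circ : Symb
  | times : Symb
  | dn : Symb
  | up : Symb
  deriving DecidableEq

/-- A (diagrammatical) weight: a sequence of symbols indexed by `ℤ`, equal to `∘`
for all but finitely many positions. -/
structure Weight : Type where
  lab : ℤ → Symb
  finite : {i : ℤ | lab i ≠ Symb.circ}.Finite

namespace Weight

/-- Two weights are equivalent (lie in the same block) if one is obtained from the
other by permuting the symbols `∧` and `∨`: the `∘`- and `×`-positions agree and the
number of `∧`'s agrees. -/
def Equiv (l m : Weight) : Prop :=
  (∀ i, l.lab i = Symb.circ ↔ m.lab i = Symb.circ) ∧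
  (∀ i, l.lab i = Symb.times ↔ m.lab i = Symb.times) ∧
  {i | l.lab i = Symb.up}.ncard = {i | m.lab i = Symb.up}.ncard

/-- The vertices of (the block of) a weight: the positions carrying `∧` or `∨`,
i.e. the positions where the block sequence has the symbol `★`. -/
def vertices (l : Weight) : Set ℤ :=
  {i | l.lab i = Symb.up ∨ l.lab i = Symb.dn}

/-- `up(Λ)`: the number of `∧`'s plus the number of `×`'s. -/
noncomputable def upNum (l : Weight) : ℕ :=
  {i | l.lab i = Symb.up}.ncard + {i | l.lab i = Symb.times}.ncard

/-- `down(Λ)`: the number of `∨`'s plus the number of `×`'s. -/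
noncomputable def downNum (l : Weight) : ℕ :=
  {i | l.lab i = Symb.dn}.ncard + {i | l.lab i = Symb.times}.ncard

/-- A block is balanced if `up(Λ) = down(Λ)`. -/
def Balanced (l : Weight) : Prop := l.upNum = l.downNum

end Weight

/-- A cup diagram (equally: the datum of a cap diagram, via the mirror image):
a set of cups `(i, j)` with `i < j` and a set of rays `i`. -/
@[ext]
structure CupDiagram : Type where
  cups : Set (ℤ × ℤ)
  rays : Set ℤ

namespace CupDiagram

/-- Compatibility of a cup diagram with the vertex set `V` of a block: endpoints lie in
`V` and are increasing, every vertex lies in exactly one arc, cups do not cross, and no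
ray lies under a cup. -/
def IsCompatible (c : CupDiagram) (V : Set ℤ) : Prop :=
  (∀ p ∈ c.cups, p.1 < p.2) ∧
  (∀ p ∈ c.cups, p.1 ∈ V ∧ p.2 ∈ V) ∧
  c.rays ⊆ V ∧
  (∀ v ∈ V, v ∈ c.rays ∨ ∃ p ∈ c.cups, v = p.1 ∨ v = p.2) ∧
  (∀ p ∈ c.cups, ∀ q ∈ c.cups,
    (p.1 = q.1 ∨ p.1 = q.2 ∨ p.2 = q.1 ∨ p.2 = q.2) → p = q) ∧
  (∀ p ∈ c.cups, p.1 ∉ c.rays ∧ p.2 ∉ c.rays) ∧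
  (∀ p ∈ c.cups, ∀ q ∈ c.cups, ¬(p.1 < q.1 ∧ q.1 < p.2 ∧ p.2 < q.2)) ∧
  (∀ p ∈ c.cups, ∀ k ∈ c.rays, ¬(p.1 < k ∧ k < p.2))

/-- The diagram `cλ` is oriented: every cup has exactly one endpoint `∨` and one `∧`,
every ray vertex is labeled `∨` or `∧`, and there are no rays `i < j` with
`λ_i = ∨` and `λ_j = ∧`. -/
def Oriented (c : CupDiagram) (l : Weight) : Prop :=
  (∀ p ∈ c.cups,
    (l.lab p.1 = Symb.dn ∧ l.lab p.2 = Symb.up) ∨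
    (l.lab p.1 = Symb.up ∧ l.lab p.2 = Symb.dn)) ∧
  (∀ k ∈ c.rays, l.lab k = Symb.up ∨ l.lab k = Symb.dn) ∧
  (∀ i ∈ c.rays, ∀ j ∈ c.rays, i < j → ¬(l.lab i = Symb.dn ∧ l.lab j = Symb.up))

/-- The degree of `cλ`: the number of clockwise cups (cups whose rightmost vertex is
labeled `∨`).  Applied to the mirror cap diagram this is the number of clockwise caps. -/
noncomputable def deg (c : CupDiagram) (l : Weight) : ℕ :=
  {p ∈ c.cups | l.lab p.2 = Symb.dn}.ncard

end CupDiagram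

/-- `c` is the cup diagram `underline l` of the weight `l`: it is compatible with the
block of `l`, the diagram `c l` is oriented, and `deg (c l) = 0`. -/
def IsLowerDiagram (c : CupDiagram) (l : Weight) : Prop :=
  c.IsCompatible l.vertices ∧ c.Oriented l ∧ c.deg l = 0

/-- Adjacency of vertices in the circle diagram `c d*`: two vertices are adjacent when
they are joined by a cup of `c` or a cap of `d*`. -/
def adjArc (c d : CupDiagram) (v w : ℤ) : Prop :=
  (v, w) ∈ c.cups ∨ (w, v) ∈ c.cups ∨ (v, w) ∈ d.cups ∨ (w, v) ∈ d.cups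

/-- `S` is a connected component of the circle diagram `c d*`. -/
def IsComponent (c d : CupDiagram) (S : Set ℤ) : Prop :=
  ∃ v ∈ S, S = {w | Relation.ReflTransGen (adjArc c d) v w}

/-- `S` is a circle of the circle diagram `c d*`: a connected component containing
no ray. -/
def IsCircle (c d : CupDiagram) (S : Set ℤ) : Prop :=
  IsComponent c d S ∧ ∀ v ∈ S, v ∉ c.rays ∧ v ∉ d.rays

/-- The degree of the oriented circle diagram `c n d*`: the number of clockwise cups
of `c n` plus the number of clockwise caps of `n d*`. -/
noncomputable def degCirc (c d : CupDiagram) (n : Weight) : ℕ :=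
  {p ∈ c.cups | n.lab p.2 = Symb.dn}.ncard + {p ∈ d.cups | n.lab p.2 = Symb.dn}.ncard

/-- The position `p_Λ(i)` of `i` in the block of `l`. -/
noncomputable def posn (l : Weight) (i : ℤ) : ℕ :=
  {j | j ≤ i ∧ (l.lab j = Symb.up ∨ l.lab j = Symb.dn)}.ncard +
    2 * {j | j ≤ i ∧ l.lab j = Symb.times}.ncard

/-- The distance `d_Λ(γ) = |p_Λ(i) − p_Λ(j)|` of an arc `γ = {i, j}`. -/
noncomputable def arcDist (l : Weight) (i j : ℤ) : ℕ := ((posn l i : ℤ) - (posn l j : ℤ)).natAbs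


/-! ## The surgery multiplication of the Blanchet–Khovanov algebra

We model the intermediate diagrams `D_l = underline λ c* c overline η` of the surgery
procedure.  Points live on two horizontal lines (`false` = bottom, `true` = top);
the bottom cup diagram is `a = underline λ`, the top cap diagram is `e* = overline η`
(recorded by the cup diagram datum `e = underline η`), the middle part consists of the
caps `γ*` and cups `γ` for `γ` in the set `R` of middle cups not yet surgered
(`R ⊆ dd.cups`, where `dd = underline μ`), together with a pair of vertical line
segments at both endpoints of every already surgered middle cup `γ ∈ dd.cups \ R`. -/

open scoped Classical

/-- A point of a stacked circle diagram: a vertex together with the line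
(`false` = bottom line, `true` = top line) it lies on. -/
abbrev Pt := ℤ × Bool

/-- Adjacency of points of the stacked circle diagram: bottom cups of `a`, bottom caps
and top cups attached to the middle cups in `R`, top caps of `e*`, and the vertical
line segments at the endpoints of the already surgered middle cups. -/
def SAdj (a e dd : CupDiagram) (R : Set (ℤ × ℤ)) (p q : Pt) : Prop :=
  (p.2 = false ∧ q.2 = false ∧
    ((p.1, q.1) ∈ a.cups ∨ (q.1, p.1) ∈ a.cups ∨ (p.1, q.1) ∈ R ∨ (q.1, p.1) ∈ R)) ∨
  (p.2 = true ∧ q.2 = true ∧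
    ((p.1, q.1) ∈ R ∨ (q.1, p.1) ∈ R ∨ (p.1, q.1) ∈ e.cups ∨ (q.1, p.1) ∈ e.cups)) ∨
  (p.1 = q.1 ∧ p.2 ≠ q.2 ∧ ∃ g ∈ dd.cups, g ∉ R ∧ (p.1 = g.1 ∨ p.1 = g.2))

/-- The connected component of the point `p` in the stacked circle diagram. -/
def SComp (a e dd : CupDiagram) (R : Set (ℤ × ℤ)) (p : Pt) : Set Pt :=
  {q | Relation.ReflTransGen (SAdj a e dd R) p q}

/-- The label of a point under an orientation `o = (ν_bottom, ν_top)` of the stacked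
circle diagram. -/
def plab (o : Weight × Weight) (p : Pt) : Symb :=
  if p.2 then o.2.lab p.1 else o.1.lab p.1

/-- An arc `g` is oriented by the weight `w`: one endpoint `∨`, one endpoint `∧`. -/
def OneUpOneDn (w : Weight) (g : ℤ × ℤ) : Prop :=
  (w.lab g.1 = Symb.dn ∧ w.lab g.2 = Symb.up) ∨
  (w.lab g.1 = Symb.up ∧ w.lab g.2 = Symb.dn)

/-- `o = (ν_bottom, ν_top)` is an orientation of the stacked circle diagram: both
weights lie in the block, all arcs are oriented and the two weights agree at the
vertical line segments. -/
def SOriented (l0 : Weight) (a e dd : CupDiagram) (R : Set (ℤ × ℤ))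
    (o : Weight × Weight) : Prop :=
  l0.Equiv o.1 ∧ l0.Equiv o.2 ∧
  (∀ g ∈ a.cups, OneUpOneDn o.1 g) ∧
  (∀ g ∈ R, OneUpOneDn o.1 g) ∧
  (∀ g ∈ R, OneUpOneDn o.2 g) ∧
  (∀ g ∈ e.cups, OneUpOneDn o.2 g) ∧
  (∀ g ∈ dd.cups, g ∉ R →
    o.1.lab g.1 = o.2.lab g.1 ∧ o.1.lab g.2 = o.2.lab g.2)

/-- `p` is a rightmost point `t(S)` of the component `S`. -/
def RightmostPt (S : Set Pt) (p : Pt) : Prop :=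
  p ∈ S ∧ ∀ q ∈ S, q.1 ≤ p.1

/-- The circle `S` is clockwise: its rightmost point is labeled `∨`. -/
def IsClockwise (o : Weight × Weight) (S : Set Pt) : Prop :=
  ∃ p, RightmostPt S p ∧ plab o p = Symb.dn

/-- The circle `S` is anticlockwise: its rightmost point is labeled `∧`. -/
def IsAnticlockwise (o : Weight × Weight) (S : Set Pt) : Prop :=
  ∃ p, RightmostPt S p ∧ plab o p = Symb.up

/-- The number of arcs of the circle `S` crossed by a vertical ray going downwards from
just below the point `p`: for a bottom point only the bottom cups of `S` spanning it,
for a top point also the middle caps and cups of `S` spanning it. -/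
noncomputable def insideCount (a : CupDiagram) (R : Set (ℤ × ℤ)) (S : Set Pt)
    (p : Pt) : ℕ :=
  {g ∈ a.cups | ((g.1 : ℤ), false) ∈ S ∧ g.1 < p.1 ∧ p.1 < g.2}.ncard +
    (if p.2 then
      {g ∈ R | ((g.1 : ℤ), false) ∈ S ∧ g.1 < p.1 ∧ p.1 < g.2}.ncard +
        {g ∈ R | ((g.1 : ℤ), true) ∈ S ∧ g.1 < p.1 ∧ p.1 < g.2}.ncard
    else 0)

/-- The circle `S` is nested inside the circle `T` (crossing-parity criterion). -/
def NestedIn (a : CupDiagram) (R : Set (ℤ × ℤ)) (S T : Set Pt) : Prop :=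
  ∃ p ∈ S, Odd (insideCount a R T p)

/-- The total distance `d_Λ(C)` of the circle `S` of a stacked circle diagram: the sum
of the distances of all its arcs (vertical line segments having distance `0`). -/
noncomputable def sDist (l : Weight) (a e : CupDiagram) (R : Set (ℤ × ℤ))
    (S : Set Pt) : ℕ :=
  (∑ᶠ g ∈ {g ∈ a.cups | ((g.1 : ℤ), false) ∈ S}, arcDist l g.1 g.2) +
    (∑ᶠ g ∈ {g ∈ R | ((g.1 : ℤ), false) ∈ S}, arcDist l g.1 g.2) +
    (∑ᶠ g ∈ {g ∈ R | ((g.1 : ℤ), true) ∈ S}, arcDist l g.1 g.2) +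
    (∑ᶠ g ∈ {g ∈ e.cups | ((g.1 : ℤ), true) ∈ S}, arcDist l g.1 g.2)

/-- The total distance of a path along consecutive points (vertical segments
contributing `0`). -/
noncomputable def sPathDist (l : Weight) (vs : List Pt) : ℕ :=
  ((vs.zip vs.tail).map fun q =>
    if q.1.2 = q.2.2 then arcDist l q.1.1 q.2.1 else 0).sum

/-- There is a path of pairwise distinct arcs from `p` to `q` of odd total distance. -/
def OddPathBetween (l : Weight) (a e dd : CupDiagram) (R : Set (ℤ × ℤ))
    (p q : Pt) : Prop :=
  ∃ vs : List Pt, vs.Chain' (SAdj a e dd R) ∧ vs.head? = some p ∧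
    vs.getLast? = some q ∧ vs.Nodup ∧ Odd (sPathDist l vs)

/-- The dot moving sign `(−1)^{d_Λ(γ^{dot})}` for a sequence of arcs connecting the
rightmost points `t(S)` and `t(T)`. -/
noncomputable def rmSign (K : Type*) [Field K] (l : Weight) (a e dd : CupDiagram)
    (R : Set (ℤ × ℤ)) (S T : Set Pt) : K :=
  if ∃ p q, RightmostPt S p ∧ RightmostPt T q ∧ OddPathBetween l a e dd R p q then -1
  else 1

/-- The dot moving sign `(−1)^{d_Λ(γ^{ndot})}` for a sequence of arcs connecting the
point `x` with the rightmost point `t(S)`. -/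
noncomputable def ptSign (K : Type*) [Field K] (l : Weight) (a e dd : CupDiagram)
    (R : Set (ℤ × ℤ)) (x : Pt) (S : Set Pt) : K :=
  if ∃ q, RightmostPt S q ∧ OddPathBetween l a e dd R x q then -1 else 1

/-- The saddle width `s_Λ(γ) = (d_Λ(γ) + 1)/2`. -/
noncomputable def saddleW (l : Weight) (γ : ℤ × ℤ) : ℕ :=
  (arcDist l γ.1 γ.2 + 1) / 2

/-- The coefficient with which the orientation `o′` of the stacked circle diagram
obtained by the surgery at the cup–cap pair of `γ` occurs in the image of the
orientation `o`; this encodes the merge and split rules (with dot moving signs,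
saddle signs and topological signs) of the Blanchet–Khovanov multiplication. -/
noncomputable def stepCoeff (K : Type*) [Field K] (l0 : Weight) (a e dd : CupDiagram)
    (R : Set (ℤ × ℤ)) (γ : ℤ × ℤ) (o o' : Weight × Weight) : K :=
  let R' : Set (ℤ × ℤ) := R \ {γ}
  let Cbot := SComp a e dd R ((γ.1 : ℤ), false)
  let Ctop := SComp a e dd R ((γ.1 : ℤ), true)
  if ¬ SOriented l0 a e dd R o ∨ ¬ SOriented l0 a e dd R' o' ∨
      ¬ (∀ p : Pt, p ∉ Cbot ∪ Ctop → plab o p = plab o' p) then 0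
  else if Cbot ≠ Ctop then
    -- merge of the two circles `Cbot` and `Ctop` into the circle `C`
    let C := SComp a e dd R' ((γ.1 : ℤ), false)
    let base : K :=
      if NestedIn a R Ctop Cbot then
        -((-1 : K) ^ ((sDist l0 a e R Ctop - 2) / 4)) * (-1 : K) ^ saddleW l0 γ
      else if NestedIn a R Cbot Ctop then
        -((-1 : K) ^ ((sDist l0 a e R Cbot - 2) / 4)) * (-1 : K) ^ saddleW l0 γ
      else 1
    if IsAnticlockwise o Cbot ∧ IsAnticlockwise o Ctop then
      (if IsAnticlockwise o' C then base else 0)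
    else if IsClockwise o Cbot ∧ IsAnticlockwise o Ctop then
      (if IsClockwise o' C then base * rmSign K l0 a e dd R' Cbot C else 0)
    else if IsAnticlockwise o Cbot ∧ IsClockwise o Ctop then
      (if IsClockwise o' C then base * rmSign K l0 a e dd R' Ctop C else 0)
    else 0
  else
    -- split of the circle `C` into the circles `Ci` and `Cj`
    let C := Cbot
    let Ci := SComp a e dd R' ((γ.1 : ℤ), false)
    let Cj := SComp a e dd R' ((γ.2 : ℤ), false)
    let Sfac : K :=
      if NestedIn a R' Ci Cj then (-1 : K) ^ ((sDist l0 a e R' Ci - 2) / 4)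
      else if NestedIn a R' Cj Ci then (-1 : K) ^ ((sDist l0 a e R' Cj - 2) / 4)
      else (-1 : K) ^ saddleW l0 γ
    if IsAnticlockwise o C then
      if IsClockwise o' Ci ∧ IsAnticlockwise o' Cj then
        ptSign K l0 a e dd R' ((γ.1 : ℤ), false) Ci * Sfac
      else if IsAnticlockwise o' Ci ∧ IsClockwise o' Cj then
        -(ptSign K l0 a e dd R' ((γ.2 : ℤ), false) Cj) * Sfac
      else 0
    else if IsClockwise o C then
      if IsClockwise o' Ci ∧ IsClockwise o' Cj then
        rmSign K l0 a e dd R C Cj * ptSign K l0 a e dd R' ((γ.1 : ℤ), false) Ci * Sfac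
      else 0
    else 0

/-- Iterating the surgery procedure along the list `L` of chosen cup–cap pairs,
starting with the set `R` of middle cups and a formal `K`-linear combination of
orientations (recorded by its coefficient function). -/
noncomputable def multAlong (K : Type*) [Field K] (l0 : Weight) (a e dd : CupDiagram) :
    List (ℤ × ℤ) → Set (ℤ × ℤ) → ((Weight × Weight) → K) → ((Weight × Weight) → K)
  | [], _, f => f
  | γ :: L, R, f =>
      multAlong K l0 a e dd L (R \ {γ})
        (fun o' => ∑ᶠ o : Weight × Weight, stepCoeff K l0 a e dd R γ o o' * f o)

/-- The coefficient function of the basis vector `underline λ ν overline μ ⊗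
underline μ ν′ overline η`: the indicator of the orientation `(ν, ν′)`. -/
noncomputable def basisInit (K : Type*) [Field K] (ν ν' : Weight) :
    (Weight × Weight) → K :=
  fun o => if o = (ν, ν') then 1 else 0

/-- The cup–cap pair of `γ` is available for surgery: `γ` is a middle cup not yet
surgered and not nested inside any other remaining arc. -/
def Available (R : Set (ℤ × ℤ)) (γ : ℤ × ℤ) : Prop :=
  γ ∈ R ∧ ¬ ∃ γ' ∈ R, γ' ≠ γ ∧ γ'.1 < γ.1 ∧ γ.2 < γ'.2

/-- `L` is an admissible order of surgeries on the set `R` of middle cups: each chosen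
cup–cap pair is available at its step, and all pairs are surgered. -/
def IsAdmissibleOrder : List (ℤ × ℤ) → Set (ℤ × ℤ) → Prop
  | [], R => R = ∅
  | γ :: L, R => Available R γ ∧ IsAdmissibleOrder L (R \ {γ})

/-- `L` is the order of surgeries used in the definition of the multiplication: at each
step the available cup–cap pair with the leftmost endpoint is chosen. -/
def IsLeftmostOrder : List (ℤ × ℤ) → Set (ℤ × ℤ) → Prop
  | [], R => R = ∅
  | γ :: L, R => Available R γ ∧ (∀ γ', Available R γ' → γ.1 ≤ γ'.1) ∧
      IsLeftmostOrder L (R \ {γ})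

/-- `(λ, ν, μ)` indexes a basis vector `underline λ ν overline μ` of the
Blanchet–Khovanov algebra of the block of `l0`: the three weights lie in the block,
`λ, μ ∈ Λ°` (their cup diagrams have no rays), and `underline λ ν` and
`ν overline μ` are oriented. -/
def ValidTriple (l0 : Weight) (t : Weight × Weight × Weight) : Prop :=
  l0.Equiv t.1 ∧ l0.Equiv t.2.1 ∧ l0.Equiv t.2.2 ∧
  (∃ c, IsLowerDiagram c t.1 ∧ c.rays = ∅) ∧
  (∃ d, IsLowerDiagram d t.2.2 ∧ d.rays = ∅) ∧
  (∀ c, IsLowerDiagram c t.1 → c.Oriented t.2.1) ∧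
  (∀ d, IsLowerDiagram d t.2.2 → d.Oriented t.2.1)

/-- The basis `B°(Λ)` of oriented circle diagrams of the Blanchet–Khovanov algebra. -/
def BKBasis (l0 : Weight) := {t : Weight × Weight × Weight // ValidTriple l0 t}

/-- The underlying `K`-vector space of the Blanchet–Khovanov algebra `A^F_Λ`: the free
`K`-vector space on the basis `B°(Λ)`. -/
abbrev BKA (K : Type*) [Field K] (l0 : Weight) := BKBasis l0 →₀ K

/-- `mult` is the multiplication of the Blanchet–Khovanov algebra `A^F_Λ`: it is
`K`-bilinear, two basis vectors with different middle cup diagrams multiply to `0`,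
and the product of two basis vectors `underline λ ν overline μ` and
`underline μ ν′ overline η` is the linear combination of basis vectors
`underline λ ν″ overline η` computed by the surgery procedure (performed along the
leftmost order of cup–cap pairs). -/
def MultSpec (K : Type*) [Field K] (l0 : Weight)
    (mult : BKA K l0 → BKA K l0 → BKA K l0) : Prop :=
  (∀ x y z : BKA K l0, mult (x + y) z = mult x z + mult y z) ∧
  (∀ x y z : BKA K l0, mult x (y + z) = mult x y + mult x z) ∧
  (∀ (k : K) (x y : BKA K l0), mult (k • x) y = k • mult x y) ∧
  (∀ (k : K) (x y : BKA K l0), mult x (k • y) = k • mult x y) ∧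
  (∀ b1 b2 : BKBasis l0, b1.1.2.2 ≠ b2.1.1 →
      mult (Finsupp.single b1 1) (Finsupp.single b2 1) = 0) ∧
  (∀ b1 b2 : BKBasis l0, b1.1.2.2 = b2.1.1 →
    ∀ (a dd e : CupDiagram) (L : List (ℤ × ℤ)),
      IsLowerDiagram a b1.1.1 → a.rays = ∅ →
      IsLowerDiagram dd b1.1.2.2 → dd.rays = ∅ →
      IsLowerDiagram e b2.1.2.2 → e.rays = ∅ →
      IsLeftmostOrder L dd.cups →
      ∀ b : BKBasis l0,
        (mult (Finsupp.single b1 1) (Finsupp.single b2 1)) b =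
          if b.1.1 = b1.1.1 ∧ b.1.2.2 = b2.1.2.2 then
            multAlong K l0 a e dd L dd.cups (basisInit K b1.1.2.1 b2.1.2.1)
              (b.1.2.1, b.1.2.1)
          else 0)

/-- `x` is an endpoint of one of the arcs in `R`. -/
def Touches (R : Set (ℤ × ℤ)) (x : ℤ) : Prop :=
  ∃ g ∈ R, x = g.1 ∨ x = g.2

namespace Weight.Equiv

theorem vertices_eq {l m : Weight} (h : l.Equiv m) : m.vertices = l.vertices := by
  ext i
  have h1 := h.1 i
  have h2 := h.2.1 i
  simp only [Weight.vertices, Set.mem_ofPred_eq]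
  cases hl : l.lab i <;> cases hm : m.lab i <;> simp_all

theorem lab_eq_of_notMem {l m : Weight} (h : l.Equiv m) {i : ℤ} (hi : i ∉ l.vertices) :
    m.lab i = l.lab i := by
  have h1 := h.1 i
  have h2 := h.2.1 i
  simp only [Weight.vertices, Set.mem_ofPred_eq] at hi
  cases hl : l.lab i <;> cases hm : m.lab i <;> simp_all

end Weight.Equiv

theorem Weight.finite_vertices (l : Weight) : l.vertices.Finite :=
  l.finite.subset fun i hi => by
    rcases hi with hi | hi <;> simp [hi]

theorem Weight.ext_lab {l m : Weight} (h : ∀ i, l.lab i = m.lab i) : l = m := by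
  cases l; cases m
  simp only [Weight.mk.injEq]
  exact funext h

theorem orientation_ext {o o' : Weight × Weight} (h : ∀ p : Pt, plab o p = plab o' p) :
    o = o' := by
  refine Prod.ext (Weight.ext_lab fun i => ?_) (Weight.ext_lab fun i => ?_)
  · simpa [plab] using h (i, false)
  · simpa [plab] using h (i, true)

namespace CupDiagram.IsCompatible

variable {c : CupDiagram} {V : Set ℤ}

theorem eq_of_touch (hc : c.IsCompatible V) {g h : ℤ × ℤ} (hg : g ∈ c.cups) (hh : h ∈ c.cups)
    {x : ℤ} (hxg : x = g.1 ∨ x = g.2) (hxh : x = h.1 ∨ x = h.2) : g = h := by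
  refine hc.2.2.2.2.1 g hg h hh ?_
  rcases hxg with rfl | rfl <;> rcases hxh with hx | hx <;> simp [hx]

theorem finite_cups (hc : c.IsCompatible V) (hV : V.Finite) : c.cups.Finite :=
  (hV.prod hV).subset fun g hg => hc.2.1 g hg

theorem touches_iff (hc : c.IsCompatible V) (hr : c.rays = ∅) (x : ℤ) :
    Touches c.cups x ↔ x ∈ V := by
  constructor
  · rintro ⟨g, hg, rfl | rfl⟩
    exacts [(hc.2.1 g hg).1, (hc.2.1 g hg).2]
  · intro hx
    rcases hc.2.2.2.1 x hx with h | h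
    · simp [hr] at h
    · exact h

/-- In a diagram without rays, every orientation has exactly one `∧` per cup. -/
theorem ncard_up (hc : c.IsCompatible V) (hr : c.rays = ∅) (w : Weight)
    (hw : w.vertices = V) (ho : ∀ g ∈ c.cups, OneUpOneDn w g) :
    {i | w.lab i = Symb.up}.ncard = c.cups.ncard := by
  let f : ℤ × ℤ → ℤ := fun g => if w.lab g.1 = Symb.up then g.1 else g.2
  have hf : ∀ g, f g = g.1 ∨ f g = g.2 := fun g => by
    simp only [f]; split_ifs <;> simp
  have himg : {i | w.lab i = Symb.up} = f '' c.cups := by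
    ext i
    simp only [Set.mem_ofPred_eq, Set.mem_image]
    constructor
    · intro hi
      have hiV : i ∈ V := hw ▸ Or.inl hi
      obtain ⟨g, hg, rfl | rfl⟩ := (hc.touches_iff hr i).2 hiV
      · exact ⟨g, hg, by simp [f, hi]⟩
      · refine ⟨g, hg, ?_⟩
        rcases ho g hg with h | h <;> simp_all [f]
    · rintro ⟨g, hg, rfl⟩
      rcases ho g hg with h | h <;> simp [f, h.1, h.2]
  rw [himg, Set.InjOn.ncard_image]
  intro g hg h hh hgh
  exact hc.eq_of_touch hg hh (hf g) (hgh ▸ hf h)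

/-- The vertices strictly below a cup are matched in pairs by the cups nested in it. -/
theorem even_ncard_between (hc : c.IsCompatible V) (hV : V.Finite) (hr : c.rays = ∅)
    {g : ℤ × ℤ} (hg : g ∈ c.cups) : Even {i | i ∈ V ∧ g.1 < i ∧ i < g.2}.ncard := by
  set A : Set (ℤ × ℤ) := {h | h ∈ c.cups ∧ g.1 < h.1 ∧ h.2 < g.2}
  have hAfin : A.Finite := (hc.finite_cups hV).subset fun h hh => hh.1
  have hlt := hc.1
  have hcross := hc.2.2.2.2.2.2.1
  have hset : {i | i ∈ V ∧ g.1 < i ∧ i < g.2} = Prod.fst '' A ∪ Prod.snd '' A := by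
    ext i
    constructor
    · rintro ⟨hi, h1, h2⟩
      obtain ⟨h, hh, hih⟩ := (hc.touches_iff hr i).2 hi
      have hne1 : g.1 ≠ h.1 ∧ g.2 ≠ h.2 := by
        constructor <;> intro heq
        · obtain rfl := hc.eq_of_touch hg hh (Or.inl rfl) (Or.inl heq)
          omega
        · obtain rfl := hc.eq_of_touch hg hh (Or.inr rfl) (Or.inr heq)
          omega
      have hne2 : g.2 ≠ h.1 ∧ g.1 ≠ h.2 := by
        constructor <;> intro heq
        · obtain rfl := hc.eq_of_touch hg hh (Or.inr rfl) (Or.inl heq)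
          omega
        · obtain rfl := hc.eq_of_touch hg hh (Or.inl rfl) (Or.inr heq)
          omega
      have c1 := hcross g hg h hh
      have c2 := hcross h hh g hg
      have l1 := hlt h hh
      rcases hih with rfl | rfl
      · exact Or.inl ⟨h, ⟨hh, by omega, by omega⟩, rfl⟩
      · exact Or.inr ⟨h, ⟨hh, by omega, by omega⟩, rfl⟩
    · rintro (⟨h, ⟨hh, h1, h2⟩, rfl⟩ | ⟨h, ⟨hh, h1, h2⟩, rfl⟩)
      · have := hlt h hh
        exact ⟨(hc.2.1 h hh).1, h1, by omega⟩
      · have := hlt h hh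
        exact ⟨(hc.2.1 h hh).2, by omega, h2⟩
  have hdisj : Disjoint (Prod.fst '' A) (Prod.snd '' A) := by
    rw [Set.disjoint_left]
    rintro i ⟨h, hh, rfl⟩ ⟨k, hk, hki⟩
    have := hc.eq_of_touch hh.1 hk.1 (Or.inl rfl) (Or.inr hki.symm)
    subst this
    have := hlt h hh.1
    omega
  rw [hset, Set.ncard_union_eq hdisj (hAfin.image _) (hAfin.image _),
    Set.InjOn.ncard_image, Set.InjOn.ncard_image]
  · exact ⟨_, rfl⟩
  · intro h hh k hk heq
    exact hc.eq_of_touch hh.1 hk.1 (Or.inr rfl) (Or.inr heq)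
  · intro h hh k hk heq
    exact hc.eq_of_touch hh.1 hk.1 (Or.inl rfl) (Or.inl heq)

theorem odd_arcDist {l : Weight} (hc : c.IsCompatible l.vertices) (hr : c.rays = ∅)
    {g : ℤ × ℤ} (hg : g ∈ c.cups) : Odd (arcDist l g.1 g.2) := by
  have hV := l.finite_vertices
  have hlt := hc.1 g hg
  have hcount : {j | j ≤ g.2 ∧ j ∈ l.vertices}.ncard =
      {j | j ≤ g.1 ∧ j ∈ l.vertices}.ncard +
        {i | i ∈ l.vertices ∧ g.1 < i ∧ i < g.2}.ncard + 1 := by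
    have hset : {j | j ≤ g.2 ∧ j ∈ l.vertices} =
        insert g.2 ({j | j ≤ g.1 ∧ j ∈ l.vertices} ∪
          {i | i ∈ l.vertices ∧ g.1 < i ∧ i < g.2}) := by
      ext j
      simp only [Set.mem_ofPred_eq, Set.mem_insert_iff, Set.mem_union]
      constructor
      · rintro ⟨h1, h2⟩
        by_cases hj : j = g.2
        · exact Or.inl hj
        · by_cases hj1 : j ≤ g.1
          · exact Or.inr (Or.inl ⟨hj1, h2⟩)
          · exact Or.inr (Or.inr ⟨h2, by omega, by omega⟩)
      · rintro (rfl | ⟨h1, h2⟩ | ⟨h1, h2, h3⟩)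
        · exact ⟨le_rfl, (hc.2.1 g hg).2⟩
        · exact ⟨by omega, h2⟩
        · exact ⟨by omega, h1⟩
    have hf1 : {j | j ≤ g.1 ∧ j ∈ l.vertices}.Finite := hV.subset fun j hj => hj.2
    have hf2 : {i | i ∈ l.vertices ∧ g.1 < i ∧ i < g.2}.Finite := hV.subset fun j hj => hj.1
    rw [hset, Set.ncard_insert_of_notMem _ (hf1.union hf2), Set.ncard_union_eq _ hf1 hf2]
    · rw [Set.disjoint_left]
      rintro j ⟨h1, -⟩ ⟨-, h2, -⟩
      omega
    · simp only [Set.mem_union, Set.mem_ofPred_eq]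
      omega
  obtain ⟨k, hk⟩ := hc.even_ncard_between hV hr hg
  have h1 : posn l g.1 = {j | j ≤ g.1 ∧ j ∈ l.vertices}.ncard +
    2 * {j | j ≤ g.1 ∧ l.lab j = Symb.times}.ncard := rfl
  have h2 : posn l g.2 = {j | j ≤ g.2 ∧ j ∈ l.vertices}.ncard +
    2 * {j | j ≤ g.2 ∧ l.lab j = Symb.times}.ncard := rfl
  unfold arcDist
  rw [Nat.odd_iff]
  omega

end CupDiagram.IsCompatible

/-- The distance of a path has the parity of the difference of the positions of its ends. -/
theorem even_sPathDist_add (l : Weight) {a e dd : CupDiagram} {R : Set (ℤ × ℤ)} :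
    ∀ (vs : List Pt) (p q : Pt), vs.IsChain (SAdj a e dd R) → vs.head? = some p →
      vs.getLast? = some q → Even (sPathDist l vs + posn l p.1 + posn l q.1)
  | [], p, q => by simp
  | [v], p, q => by
      intro _ hp hq
      simp only [List.head?_cons, Option.some.injEq, List.getLast?_singleton] at hp hq
      subst hp hq
      simp [sPathDist, ← two_mul]
  | v :: w :: vs, p, q => by
      intro hch hp hq
      rw [List.isChain_cons_cons] at hch
      have ih := even_sPathDist_add l (w :: vs) w q hch.2 rfl (by simpa using hq)
      simp only [List.head?_cons, Option.some.injEq] at hp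
      subst hp
      have hstep : sPathDist l (v :: w :: vs) =
          (if v.2 = w.2 then arcDist l v.1 w.1 else 0) + sPathDist l (w :: vs) := by
        simp [sPathDist]
      rw [hstep]
      split_ifs with hvw
      · unfold arcDist
        rw [Nat.even_iff] at ih ⊢
        omega
      · have hx : v.1 = w.1 := by
          rcases hch.1 with h | h | h
          · exact absurd (h.1.trans h.2.1.symm) hvw
          · exact absurd (h.1.trans h.2.1.symm) hvw
          · exact h.1
        rw [hx, zero_add]
        exact ih

theorem not_oddPathBetween_of_fst_eq (l : Weight) {a e dd : CupDiagram} {R : Set (ℤ × ℤ)}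
    {p q : Pt} (h : p.1 = q.1) : ¬ OddPathBetween l a e dd R p q := by
  rintro ⟨vs, h1, h2, h3, -, h5⟩
  have := even_sPathDist_add l vs p q h1 h2 h3
  rw [Nat.even_iff] at this
  rw [Nat.odd_iff] at h5
  rw [h] at this
  omega

theorem rmSign_eq_one (K : Type*) [Field K] (l : Weight) {a e dd : CupDiagram}
    {R : Set (ℤ × ℤ)} {S T : Set Pt}
    (h : ∀ p q, RightmostPt S p → RightmostPt T q → p.1 = q.1) :
    rmSign K l a e dd R S T = 1 := by
  unfold rmSign
  rw [if_neg]
  rintro ⟨p, q, hp, hq, hpq⟩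
  exact not_oddPathBetween_of_fst_eq l (h p q hp hq) hpq

theorem OneUpOneDn.agree_iff {w w' : Weight} {g : ℤ × ℤ} (h : OneUpOneDn w g)
    (h' : OneUpOneDn w' g) : w.lab g.1 = w'.lab g.1 ↔ w.lab g.2 = w'.lab g.2 := by
  rcases h with h | h <;> rcases h' with h' | h' <;> simp [h.1, h.2, h'.1, h'.2]

/-- Two orientations agree at a point if and only if they agree at an adjacent point. -/
theorem SOriented.agree_iff_of_adj {l0 : Weight} {a e dd : CupDiagram} {R : Set (ℤ × ℤ)}
    {o o' : Weight × Weight} (h : SOriented l0 a e dd R o) (h' : SOriented l0 a e dd R o')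
    {p q : Pt} (hpq : SAdj a e dd R p q) :
    plab o p = plab o' p ↔ plab o q = plab o' q := by
  obtain ⟨-, -, ha, hR1, hR2, he, hv⟩ := h
  obtain ⟨-, -, ha', hR1', hR2', he', hv'⟩ := h'
  obtain ⟨x, b⟩ := p
  obtain ⟨y, b'⟩ := q
  rcases hpq with ⟨hb, hb', h⟩ | ⟨hb, hb', h⟩ | ⟨hx, hb, g, hg, hgR, hend⟩
  · simp only at hb hb' h
    subst hb hb'
    simp only [plab, Bool.false_eq_true, if_false]
    rcases h with h | h | h | h
    · exact (ha _ h).agree_iff (ha' _ h)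
    · exact ((ha _ h).agree_iff (ha' _ h)).symm
    · exact (hR1 _ h).agree_iff (hR1' _ h)
    · exact ((hR1 _ h).agree_iff (hR1' _ h)).symm
  · simp only at hb hb' h
    subst hb hb'
    simp only [plab, if_true]
    rcases h with h | h | h | h
    · exact (hR2 _ h).agree_iff (hR2' _ h)
    · exact ((hR2 _ h).agree_iff (hR2' _ h)).symm
    · exact (he _ h).agree_iff (he' _ h)
    · exact ((he _ h).agree_iff (he' _ h)).symm
  · simp only at hx hb hend
    subst hx
    have e1 : o.1.lab x = o.2.lab x := by
      rcases hend with rfl | rfl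
      exacts [(hv g hg hgR).1, (hv g hg hgR).2]
    have e2 : o'.1.lab x = o'.2.lab x := by
      rcases hend with rfl | rfl
      exacts [(hv' g hg hgR).1, (hv' g hg hgR).2]
    cases b <;> cases b' <;> simp_all [plab]

theorem SOriented.agree_on_component {l0 : Weight} {a e dd : CupDiagram} {R : Set (ℤ × ℤ)}
    {o o' : Weight × Weight} (h : SOriented l0 a e dd R o) (h' : SOriented l0 a e dd R o')
    {x p q : Pt} (hp : p ∈ SComp a e dd R x) (hq : q ∈ SComp a e dd R x)
    (heq : plab o p = plab o' p) : plab o q = plab o' q := by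
  have key : ∀ r ∈ SComp a e dd R x, (plab o x = plab o' x ↔ plab o r = plab o' r) := by
    intro r hr
    induction hr with
    | refl => rfl
    | tail _ hst ih => exact ih.trans (h.agree_iff_of_adj h' hst)
  exact (key q hq).1 ((key p hp).2 heq)

theorem SComp.closed {a e dd : CupDiagram} {R : Set (ℤ × ℤ)} {x p q : Pt}
    (hp : p ∈ SComp a e dd R x) (hpq : SAdj a e dd R p q) : q ∈ SComp a e dd R x :=
  Relation.ReflTransGen.tail hp hpq

theorem SComp.self_mem {a e dd : CupDiagram} {R : Set (ℤ × ℤ)} {x : Pt} :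
    x ∈ SComp a e dd R x :=
  Relation.ReflTransGen.refl

/-- A component is contained in every set containing its base point and closed under
adjacency. -/
theorem SComp.subset_of_closed {a e dd : CupDiagram} {R : Set (ℤ × ℤ)} {x : Pt} {A : Set Pt}
    (hx : x ∈ A) (hA : ∀ p ∈ A, ∀ q, SAdj a e dd R p q → q ∈ A) : SComp a e dd R x ⊆ A := by
  intro p hp
  induction hp with
  | refl => exact hx
  | tail _ hst ih => exact hA _ ih _ hst

theorem SAdj.vertical {a e dd : CupDiagram} {R : Set (ℤ × ℤ)} {p q : Pt}
    (h : SAdj a e dd R p q) (hne : p.2 ≠ q.2) : p.1 = q.1 ∧ Touches (dd.cups \ R) p.1 := by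
  rcases h with h | h | ⟨h1, -, g, hg, hgR, hend⟩
  · exact absurd (h.1.trans h.2.1.symm) hne
  · exact absurd (h.1.trans h.2.1.symm) hne
  · exact ⟨h1, g, ⟨hg, hgR⟩, hend⟩

/-- The data of a product with an idempotent: the outer diagram on the side `s` coincides
with the middle diagram `dd`, which is the cup diagram of `κ`, and the other factor is
oriented by `ν`. -/
structure UnitSetup (l0 κ ν : Weight) (a e dd : CupDiagram) (s : Bool) : Prop where
  side : (s = false ∧ a = dd) ∨ (s = true ∧ e = dd)
  compat_a : a.IsCompatible l0.vertices
  compat_e : e.IsCompatible l0.vertices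
  compat_dd : dd.IsCompatible l0.vertices
  rays_dd : dd.rays = ∅
  equiv_κ : l0.Equiv κ
  equiv_ν : l0.Equiv ν
  oriented_a : ∀ g ∈ a.cups, OneUpOneDn ν g
  oriented_e : ∀ g ∈ e.cups, OneUpOneDn ν g
  anticlockwise : ∀ g ∈ dd.cups, κ.lab g.1 = Symb.dn ∧ κ.lab g.2 = Symb.up

/-- A stage of the surgery procedure with remaining cups `R`: no cup surgered so far is
nested in a remaining one. -/
structure IsStage (dd : CupDiagram) (R : Set (ℤ × ℤ)) : Prop where
  subset : R ⊆ dd.cups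
  outer : ∀ g ∈ dd.cups, g ∉ R → ∀ h ∈ R, ¬ (h.1 < g.1 ∧ g.2 < h.2)

theorem IsStage.diff {dd : CupDiagram} {R : Set (ℤ × ℤ)} (hR : IsStage dd R) {γ : ℤ × ℤ}
    (hγ : Available R γ) : IsStage dd (R \ {γ}) := by
  refine ⟨fun g hg => hR.subset hg.1, fun g hg hgR h hh hn => ?_⟩
  by_cases hgR' : g ∈ R
  · have : g = γ := by
      by_contra hne
      exact hgR ⟨hgR', hne⟩
    subst this
    exact hγ.2 ⟨h, hh.1, hh.2, hn⟩
  · exact hR.outer g hg hgR' h hh.1 hn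

/-- The weight labeled as `κ` at the endpoints of the cups in `R` and as `ν` elsewhere. -/
noncomputable def mixedWeight (κ ν : Weight) (R : Set (ℤ × ℤ)) : Weight where
  lab i := if Touches R i then κ.lab i else ν.lab i
  finite := (κ.finite.union ν.finite).subset fun i hi => by
    simp only [Set.mem_ofPred_eq] at hi
    split_ifs at hi
    exacts [Or.inl hi, Or.inr hi]

/-- The orientation reached at the stage with remaining cups `R`. -/
noncomputable def stageOrientation (κ ν : Weight) (s : Bool) (R : Set (ℤ × ℤ)) :
    Weight × Weight :=
  if s then (ν, mixedWeight κ ν R) else (mixedWeight κ ν R, ν)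

theorem plab_stageOrientation (κ ν : Weight) (s : Bool) (R : Set (ℤ × ℤ)) (p : Pt) :
    plab (stageOrientation κ ν s R) p =
      if p.2 = s ∧ Touches R p.1 then κ.lab p.1 else ν.lab p.1 := by
  obtain ⟨x, b⟩ := p
  cases b <;> cases s <;> simp [plab, stageOrientation, mixedWeight]

namespace UnitSetup

variable {l0 κ ν : Weight} {a e dd : CupDiagram} {s : Bool} {R : Set (ℤ × ℤ)} {γ : ℤ × ℤ}

theorem oriented_dd (H : UnitSetup l0 κ ν a e dd s) : ∀ g ∈ dd.cups, OneUpOneDn ν g := by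
  rcases H.side with ⟨-, rfl⟩ | ⟨-, rfl⟩
  exacts [H.oriented_a, H.oriented_e]

theorem mem_iff_touches (H : UnitSetup l0 κ ν a e dd s) (hR : R ⊆ dd.cups) {g : ℤ × ℤ}
    (hg : g ∈ dd.cups) {x : ℤ} (hx : x = g.1 ∨ x = g.2) : Touches R x ↔ g ∈ R := by
  constructor
  · rintro ⟨h, hh, hxh⟩
    rwa [H.compat_dd.eq_of_touch hg (hR hh) hx hxh]
  · exact fun h => ⟨g, h, hx⟩

theorem oneUpOneDn_mixed (H : UnitSetup l0 κ ν a e dd s) (hR : R ⊆ dd.cups) :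
    ∀ g ∈ dd.cups, OneUpOneDn (mixedWeight κ ν R) g := by
  intro g hg
  have h1 := H.mem_iff_touches hR hg (Or.inl rfl)
  have h2 := H.mem_iff_touches hR hg (Or.inr rfl)
  by_cases hgR : g ∈ R
  · left
    simpa [mixedWeight, h1, h2, hgR] using H.anticlockwise g hg
  · have := H.oriented_dd g hg
    simpa [OneUpOneDn, mixedWeight, h1, h2, hgR] using this

theorem equiv_mixed (H : UnitSetup l0 κ ν a e dd s) (hR : R ⊆ dd.cups) :
    l0.Equiv (mixedWeight κ ν R) := by
  have hc : ∀ i, l0.lab i = Symb.circ ↔ (mixedWeight κ ν R).lab i = Symb.circ := fun i => by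
    simp only [mixedWeight]
    split_ifs
    exacts [H.equiv_κ.1 i, H.equiv_ν.1 i]
  have ht : ∀ i, l0.lab i = Symb.times ↔ (mixedWeight κ ν R).lab i = Symb.times := fun i => by
    simp only [mixedWeight]
    split_ifs
    exacts [H.equiv_κ.2.1 i, H.equiv_ν.2.1 i]
  have hv : (mixedWeight κ ν R).vertices = l0.vertices := by
    ext i
    have h1 := hc i
    have h2 := ht i
    simp only [Weight.vertices, Set.mem_ofPred_eq]
    cases hl : l0.lab i <;> cases hm : (mixedWeight κ ν R).lab i <;> simp_all
  refine ⟨hc, ht, ?_⟩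
  rw [H.equiv_ν.2.2, H.compat_dd.ncard_up H.rays_dd ν H.equiv_ν.vertices_eq H.oriented_dd,
    H.compat_dd.ncard_up H.rays_dd _ hv (H.oneUpOneDn_mixed hR)]

theorem sOriented_stage (H : UnitSetup l0 κ ν a e dd s) (hR : R ⊆ dd.cups) :
    SOriented l0 a e dd R (stageOrientation κ ν s R) := by
  have hmix := H.oneUpOneDn_mixed hR
  have hv : ∀ g ∈ dd.cups, g ∉ R → (mixedWeight κ ν R).lab g.1 = ν.lab g.1 ∧
      (mixedWeight κ ν R).lab g.2 = ν.lab g.2 := by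
    intro g hg hgR
    have h1 := H.mem_iff_touches hR hg (Or.inl rfl)
    have h2 := H.mem_iff_touches hR hg (Or.inr rfl)
    simp [mixedWeight, h1, h2, hgR]
  rcases H.side with ⟨rfl, hdd⟩ | ⟨rfl, hdd⟩
  · exact ⟨H.equiv_mixed hR, H.equiv_ν, hdd ▸ hmix, fun g hg => hmix g (hR hg),
      fun g hg => H.oriented_dd g (hR hg), H.oriented_e, hv⟩
  · exact ⟨H.equiv_ν, H.equiv_mixed hR, H.oriented_a, fun g hg => H.oriented_dd g (hR hg),
      fun g hg => hmix g (hR hg), hdd ▸ hmix,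
      fun g hg hgR => ⟨(hv g hg hgR).1.symm, (hv g hg hgR).2.symm⟩⟩

/-- On the side `s`, all arcs belong to the middle diagram. -/
theorem arc_of_adj (H : UnitSetup l0 κ ν a e dd s) (hR : R ⊆ dd.cups) {p q : Pt}
    (h : SAdj a e dd R p q) (hp : p.2 = s) (hq : q.2 = s) :
    ∃ g ∈ dd.cups, (p.1 = g.1 ∧ q.1 = g.2) ∨ (p.1 = g.2 ∧ q.1 = g.1) := by
  obtain ⟨x, b⟩ := p
  obtain ⟨y, b'⟩ := q
  have h1 : (x, y) ∈ dd.cups → ∃ g ∈ dd.cups, (x = g.1 ∧ y = g.2) ∨ (x = g.2 ∧ y = g.1) :=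
    fun h => ⟨_, h, Or.inl ⟨rfl, rfl⟩⟩
  have h2 : (y, x) ∈ dd.cups → ∃ g ∈ dd.cups, (x = g.1 ∧ y = g.2) ∨ (x = g.2 ∧ y = g.1) :=
    fun h => ⟨_, h, Or.inr ⟨rfl, rfl⟩⟩
  simp only at hp hq
  rcases H.side with ⟨rfl, hdd⟩ | ⟨rfl, hdd⟩ <;> subst hdd hp hq <;>
    simp only [SAdj, Bool.false_eq_true, Bool.true_eq_false, false_and, true_and, ne_eq,
      not_true_eq_false, and_false, or_false, false_or] at h
  · rcases h with h | h | h | h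
    exacts [h1 h, h2 h, h1 (hR h), h2 (hR h)]
  · rcases h with h | h | h | h
    exacts [h1 (hR h), h2 (hR h), h1 h, h2 h]

/-- On the side `s`, the component of a remaining cup consists of this cup and its mirror
image. -/
theorem small_component (H : UnitSetup l0 κ ν a e dd s) (hR : R ⊆ dd.cups) (hγ : γ ∈ R) :
    SComp a e dd R (γ.1, s) = {(γ.1, s), (γ.2, s)} := by
  apply Set.Subset.antisymm
  · refine SComp.subset_of_closed (by simp) fun p hp q hpq => ?_
    have hps : p.2 = s := by rcases hp with rfl | rfl <;> rfl
    have hpγ : p.1 = γ.1 ∨ p.1 = γ.2 := by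
      rcases hp with rfl | rfl
      exacts [Or.inl rfl, Or.inr rfl]
    by_cases hqs : q.2 = s
    · obtain ⟨g, hg, hpq'⟩ := H.arc_of_adj hR hpq hps hqs
      have : g = γ := H.compat_dd.eq_of_touch (x := p.1) hg (hR hγ)
        (by rcases hpq' with h | h <;> simp [h.1]) hpγ
      subst this
      rcases hpq' with h | h
      · exact Or.inr (Prod.ext h.2 hqs)
      · exact Or.inl (Prod.ext h.2 hqs)
    · obtain ⟨-, g, ⟨hg, hgR⟩, hend⟩ := hpq.vertical fun h => hqs (h ▸ hps)
      exact absurd (H.compat_dd.eq_of_touch hg (hR hγ) hend hpγ ▸ hγ) hgR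
  · rintro p (rfl | rfl)
    · exact SComp.self_mem
    · refine SComp.closed SComp.self_mem ?_
      cases s <;> simp [SAdj, hγ]

/-- The other component involved in the surgery meets the side `s` only in endpoints of cups
surgered before. -/
theorem big_component_touches (H : UnitSetup l0 κ ν a e dd s) (hR : R ⊆ dd.cups)
    {p : Pt} (hp : p ∈ SComp a e dd R (γ.1, !s)) (hps : p.2 = s) :
    Touches (dd.cups \ R) p.1 := by
  refine SComp.subset_of_closed (A := {p | p.2 = s → Touches (dd.cups \ R) p.1})
    (by simp) (fun p hp q hpq hqs => ?_) hp hps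
  by_cases hps : p.2 = s
  · obtain ⟨g, hg, hpq'⟩ := H.arc_of_adj hR hpq hps hqs
    obtain ⟨h, hh, hend⟩ := hp hps
    have : g = h := H.compat_dd.eq_of_touch (x := p.1) hg hh.1
      (by rcases hpq' with h | h <;> simp [h.1]) hend
    subst this
    exact ⟨g, hh, by rcases hpq' with h | h <;> simp [h.2]⟩
  · obtain ⟨h1, h2⟩ := hpq.vertical fun h => hps (h.trans hqs)
    exact h1 ▸ h2

theorem component_subset_vertices (H : UnitSetup l0 κ ν a e dd s) (hR : R ⊆ dd.cups) {x : Pt}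
    (hx : x.1 ∈ l0.vertices) : SComp a e dd R x ⊆ {p | p.1 ∈ l0.vertices} := by
  refine SComp.subset_of_closed hx fun p hp q hpq => ?_
  have hdd := H.compat_dd.2.1
  rcases hpq with ⟨-, -, h⟩ | ⟨-, -, h⟩ | ⟨h, -⟩
  · rcases h with h | h | h | h
    exacts [(H.compat_a.2.1 _ h).2, (H.compat_a.2.1 _ h).1, (hdd _ (hR h)).2, (hdd _ (hR h)).1]
  · rcases h with h | h | h | h
    exacts [(hdd _ (hR h)).2, (hdd _ (hR h)).1, (H.compat_e.2.1 _ h).2, (H.compat_e.2.1 _ h).1]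
  · change q.1 ∈ l0.vertices
    exact h ▸ hp

theorem finite_component (H : UnitSetup l0 κ ν a e dd s) (hR : R ⊆ dd.cups) {x : Pt}
    (hx : x.1 ∈ l0.vertices) : (SComp a e dd R x).Finite :=
  (l0.finite_vertices.prod (Set.finite_univ (α := Bool))).subset fun _ hp =>
    ⟨H.component_subset_vertices hR hx hp, Set.mem_univ _⟩

/-- The surgery at `γ` merges the two components meeting `γ`. -/
theorem merged_component (H : UnitSetup l0 κ ν a e dd s) (hR : R ⊆ dd.cups) (hγ : γ ∈ R) :
    SComp a e dd (R \ {γ}) (γ.1, false) =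
      SComp a e dd R (γ.1, false) ∪ SComp a e dd R (γ.1, true) := by
  have hγd := hR hγ
  have hfour : ∀ q : Pt, q.1 = γ.1 ∨ q.1 = γ.2 →
      q ∈ SComp a e dd R (γ.1, false) ∪ SComp a e dd R (γ.1, true) := by
    rintro ⟨x, b⟩ (rfl | rfl)
    · cases b
      exacts [Or.inl SComp.self_mem, Or.inr SComp.self_mem]
    · cases b
      · exact Or.inl (SComp.closed SComp.self_mem (by simp [SAdj, hγ]))
      · exact Or.inr (SComp.closed SComp.self_mem (by simp [SAdj, hγ]))
  have hvert : ∀ x b, x = γ.1 ∨ x = γ.2 → SAdj a e dd (R \ {γ}) (x, b) (x, !b) :=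
    fun x b hx => Or.inr (Or.inr ⟨rfl, by simp, γ, hγd, by simp, hx⟩)
  have hfour' : ∀ q : Pt, q.1 = γ.1 ∨ q.1 = γ.2 →
      q ∈ SComp a e dd (R \ {γ}) (γ.1, false) := by
    have h1 : ∀ b, ((γ.1, b) : Pt) ∈ SComp a e dd (R \ {γ}) (γ.1, false) := by
      intro b
      cases b
      · exact SComp.self_mem
      · exact SComp.closed SComp.self_mem (hvert _ false (Or.inl rfl))
    have h2 : ((γ.2, s) : Pt) ∈ SComp a e dd (R \ {γ}) (γ.1, false) := by
      refine SComp.closed (h1 s) ?_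
      rcases H.side with ⟨rfl, rfl⟩ | ⟨rfl, rfl⟩ <;> simp [SAdj, hγd]
    rintro ⟨x, b⟩ (rfl | rfl)
    · exact h1 b
    · by_cases hb : b = s
      · exact hb ▸ h2
      · have : b = !s := by cases b <;> cases s <;> simp_all
        exact this ▸ SComp.closed h2 (hvert _ s (Or.inr rfl))
  have hback : ∀ p ∈ SComp a e dd (R \ {γ}) (γ.1, false), ∀ q, SAdj a e dd R p q →
      q ∈ SComp a e dd (R \ {γ}) (γ.1, false) := by
    intro p hp q hpq
    by_cases hq : q.1 = γ.1 ∨ q.1 = γ.2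
    · exact hfour' q hq
    · refine SComp.closed hp ?_
      have h1 : (p.1, q.1) ∈ R → (p.1, q.1) ∈ R \ {γ} := fun h =>
        ⟨h, fun heq => hq (Or.inr (congrArg Prod.snd heq))⟩
      have h2 : (q.1, p.1) ∈ R → (q.1, p.1) ∈ R \ {γ} := fun h =>
        ⟨h, fun heq => hq (Or.inl (congrArg Prod.fst heq))⟩
      rcases hpq with ⟨hp, hq, h⟩ | ⟨hp, hq, h⟩ | ⟨h, hne, g, hg, hgR, hend⟩
      · exact Or.inl ⟨hp, hq, h.imp_right (Or.imp_right (Or.imp h1 h2))⟩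
      · exact Or.inr (Or.inl ⟨hp, hq, h.imp h1 (Or.imp_left h2)⟩)
      · exact Or.inr (Or.inr ⟨h, hne, g, hg, fun h => hgR h.1, hend⟩)
  apply Set.Subset.antisymm
  · refine SComp.subset_of_closed (hfour _ (Or.inl rfl)) fun p hp q hpq => ?_
    by_cases hq : q.1 = γ.1 ∨ q.1 = γ.2
    · exact hfour q hq
    · have hpq' : SAdj a e dd R p q := by
        rcases hpq with ⟨hp, hq, h⟩ | ⟨hp, hq, h⟩ | ⟨h, hne, g, hg, hgR, hend⟩
        · exact Or.inl ⟨hp, hq, h.imp_right (Or.imp_right (Or.imp (·.1) (·.1)))⟩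
        · exact Or.inr (Or.inl ⟨hp, hq, h.imp (·.1) (Or.imp_left (·.1))⟩)
        · refine Or.inr (Or.inr ⟨h, hne, g, hg, fun hg' => hgR ⟨hg', ?_⟩, hend⟩)
          rintro rfl
          exact hq (h ▸ hend)
      rcases hp with hp | hp
      exacts [Or.inl (SComp.closed hp hpq'), Or.inr (SComp.closed hp hpq')]
  · exact Set.union_subset (SComp.subset_of_closed (hfour' _ (Or.inl rfl)) hback)
      (SComp.subset_of_closed (hfour' _ (Or.inl rfl)) hback)

/-- The endpoints of cups surgered so far do not lie below a remaining cup. -/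
theorem not_between (H : UnitSetup l0 κ ν a e dd s) (hR : IsStage dd R) (hγ : γ ∈ R) {x : ℤ}
    (hx : Touches (dd.cups \ R) x) : ¬ (γ.1 < x ∧ x < γ.2) := by
  obtain ⟨g, ⟨hg, hgR⟩, hend⟩ := hx
  have hγd := hR.subset hγ
  have hne : g ≠ γ := fun h => hgR (h ▸ hγ)
  have n1 : g.1 ≠ γ.1 := fun h => hne (H.compat_dd.eq_of_touch hg hγd (Or.inl rfl) (Or.inl h))
  have n2 : g.2 ≠ γ.2 := fun h => hne (H.compat_dd.eq_of_touch hg hγd (Or.inr rfl) (Or.inr h))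
  have c1 := H.compat_dd.2.2.2.2.2.2.1 g hg γ hγd
  have c2 := H.compat_dd.2.2.2.2.2.2.1 γ hγd g hg
  have l1 := H.compat_dd.1 g hg
  have o1 := hR.outer g hg hgR γ hγ
  rcases hend with rfl | rfl <;> omega

theorem eq_of_mem_small (H : UnitSetup l0 κ ν a e dd s) (hR : R ⊆ dd.cups) (hγ : γ ∈ R)
    {g : ℤ × ℤ} (hg : g ∈ dd.cups) {b : Bool}
    (h : ((g.1, b) : Pt) ∈ ({(γ.1, s), (γ.2, s)} : Set Pt)) : g = γ := by
  have hend : g.1 = γ.1 ∨ g.1 = γ.2 := by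
    simp only [Set.mem_insert_iff, Set.mem_singleton_iff, Prod.mk.injEq] at h
    exact h.imp (·.1) (·.1)
  exact H.compat_dd.eq_of_touch hg (hR hγ) (Or.inl rfl) hend

theorem sDist_small (H : UnitSetup l0 κ ν a e dd s) (hR : R ⊆ dd.cups) (hγ : γ ∈ R) :
    sDist l0 a e R {(γ.1, s), (γ.2, s)} = 2 * arcDist l0 γ.1 γ.2 := by
  have hself : ∀ A : Set (ℤ × ℤ), A ⊆ dd.cups → γ ∈ A →
      {g | g ∈ A ∧ ((g.1, s) : Pt) ∈ ({(γ.1, s), (γ.2, s)} : Set Pt)} = {γ} := by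
    intro A hA hγA
    ext g
    simp only [Set.mem_ofPred_eq, Set.mem_singleton_iff]
    constructor
    · exact fun h => H.eq_of_mem_small hR hγ (hA h.1) h.2
    · rintro rfl
      exact ⟨hγA, by simp⟩
  have hother : ∀ A : Set (ℤ × ℤ),
      {g | g ∈ A ∧ ((g.1, !s) : Pt) ∈ ({(γ.1, s), (γ.2, s)} : Set Pt)} = ∅ := by
    intro A
    ext g
    simp
  have h1 := hself R hR hγ
  have h2 := hother R
  have h3 := hself dd.cups subset_rfl (hR hγ)
  unfold sDist
  rcases H.side with ⟨rfl, rfl⟩ | ⟨rfl, rfl⟩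
  · have h4 := hother e.cups
    simp only [Bool.not_false] at h2 h4
    rw [h1, h2, h3, h4]
    simp only [finsum_mem_singleton, finsum_mem_empty]
    omega
  · have h4 := hother a.cups
    simp only [Bool.not_true] at h2 h4
    rw [h1, h2, h3, h4]
    simp only [finsum_mem_singleton, finsum_mem_empty]
    omega

/-- The topological sign and the saddle sign of a merge with a small circle cancel. -/
theorem nested_sign (H : UnitSetup l0 κ ν a e dd s) (hR : R ⊆ dd.cups) (hγ : γ ∈ R)
    (K : Type*) [Field K] :
    -((-1 : K) ^ ((sDist l0 a e R {(γ.1, s), (γ.2, s)} - 2) / 4)) * (-1 : K) ^ saddleW l0 γ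
      = 1 := by
  obtain ⟨k, hk⟩ := H.compat_dd.odd_arcDist H.rays_dd (hR hγ)
  rw [H.sDist_small hR hγ, saddleW, hk]
  have h1 : (2 * (2 * k + 1) - 2) / 4 = k := by omega
  have h2 : (2 * k + 1 + 1) / 2 = k + 1 := by omega
  rw [h1, h2, pow_succ]
  have : (-1 : K) ^ k * (-1 : K) ^ k = 1 := by
    rw [← mul_pow]; simp
  linear_combination this

/-- The other component involved in the surgery is not nested in the small circle. -/
theorem not_nestedIn_small (H : UnitSetup l0 κ ν a e dd s) (hR : IsStage dd R) (hγ : γ ∈ R) :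
    ¬ NestedIn a R (SComp a e dd R (γ.1, !s)) {(γ.1, s), (γ.2, s)} := by
  rintro ⟨p, hp, hodd⟩
  have hbig := H.big_component_touches hR.subset hp
  rw [← Nat.not_even_iff_odd] at hodd
  apply hodd
  have hside := H.side
  unfold insideCount
  rcases hside with ⟨rfl, rfl⟩ | ⟨rfl, rfl⟩
  · have htop : {g ∈ R | ((g.1, true) : Pt) ∈ ({(γ.1, false), (γ.2, false)} : Set Pt) ∧
        g.1 < p.1 ∧ p.1 < g.2} = ∅ := by
      ext g
      simp
    have heq : {g ∈ R | ((g.1, false) : Pt) ∈ ({(γ.1, false), (γ.2, false)} : Set Pt) ∧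
        g.1 < p.1 ∧ p.1 < g.2} =
        {g ∈ a.cups | ((g.1, false) : Pt) ∈ ({(γ.1, false), (γ.2, false)} : Set Pt) ∧
        g.1 < p.1 ∧ p.1 < g.2} := by
      ext g
      refine ⟨fun h => ⟨hR.subset h.1, h.2⟩, fun h => ⟨?_, h.2⟩⟩
      rwa [H.eq_of_mem_small hR.subset hγ h.1 h.2.1]
    rw [htop, heq]
    by_cases hpb : p.2 = false
    · have hempty : {g ∈ a.cups | ((g.1, false) : Pt) ∈
          ({(γ.1, false), (γ.2, false)} : Set Pt) ∧ g.1 < p.1 ∧ p.1 < g.2} = ∅ := by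
        refine Set.eq_empty_of_forall_notMem fun g hg => ?_
        have := H.eq_of_mem_small hR.subset hγ hg.1 hg.2.1
        subst this
        exact H.not_between hR hγ (hbig hpb) hg.2.2
      rw [hempty]
      simp
    · simp [hpb]
  · have hbot : ∀ A : Set (ℤ × ℤ),
        {g ∈ A | ((g.1, false) : Pt) ∈ ({(γ.1, true), (γ.2, true)} : Set Pt) ∧
        g.1 < p.1 ∧ p.1 < g.2} = ∅ := by
      intro A
      ext g
      simp
    rw [hbot, hbot]
    split_ifs with hpb
    · have hempty : {g ∈ R | ((g.1, true) : Pt) ∈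
          ({(γ.1, true), (γ.2, true)} : Set Pt) ∧ g.1 < p.1 ∧ p.1 < g.2} = ∅ := by
        refine Set.eq_empty_of_forall_notMem fun g hg => ?_
        have := H.eq_of_mem_small hR.subset hγ (hR.subset hg.1) hg.2.1
        subst this
        exact H.not_between hR hγ (hbig hpb) hg.2.2
      rw [hempty]
      simp
    · simp

/-- Merging with a small circle has the sign `1`. -/
theorem base_eq_one (H : UnitSetup l0 κ ν a e dd s) (hR : IsStage dd R) (hγ : γ ∈ R)
    (K : Type*) [Field K] {Cbot Ctop : Set Pt} (hbot : Cbot = SComp a e dd R (γ.1, false))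
    (htop : Ctop = SComp a e dd R (γ.1, true)) :
    (if NestedIn a R Ctop Cbot then
        -((-1 : K) ^ ((sDist l0 a e R Ctop - 2) / 4)) * (-1 : K) ^ saddleW l0 γ
      else if NestedIn a R Cbot Ctop then
        -((-1 : K) ^ ((sDist l0 a e R Cbot - 2) / 4)) * (-1 : K) ^ saddleW l0 γ
      else 1) = 1 := by
  have hsmall := H.small_component hR.subset hγ
  have hn := H.not_nestedIn_small hR hγ
  have hsign := H.nested_sign hR.subset hγ K
  rw [← hsmall] at hn hsign
  subst hbot htop
  rcases Bool.eq_false_or_eq_true s with rfl | rfl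
  · rw [Bool.not_true] at hn
    rw [if_neg hn, hsign]
    simp
  · rw [Bool.not_false] at hn
    rw [if_neg hn, hsign]
    simp

theorem plab_stage_diff (κ ν : Weight) {p : Pt}
    (hp : p ∉ ({(γ.1, s), (γ.2, s)} : Set Pt)) :
    plab (stageOrientation κ ν s R) p = plab (stageOrientation κ ν s (R \ {γ})) p := by
  rw [plab_stageOrientation, plab_stageOrientation]
  by_cases hps : p.2 = s
  · have : Touches R p.1 ↔ Touches (R \ {γ}) p.1 := by
      constructor
      · rintro ⟨g, hg, hend⟩
        refine ⟨g, ⟨hg, ?_⟩, hend⟩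
        rintro rfl
        exact hp (hend.imp (fun h => Prod.ext h hps) fun h => Prod.ext h hps)
      · rintro ⟨g, hg, hend⟩
        exact ⟨g, hg.1, hend⟩
    simp [hps, this]
  · simp [hps]

/-- A surgery of a small circle fixes the other circle with its orientation. -/
theorem stepCoeff_eq (H : UnitSetup l0 κ ν a e dd s) (hR : IsStage dd R) (hγ : γ ∈ R)
    (K : Type*) [Field K] (o' : Weight × Weight) :
    stepCoeff K l0 a e dd R γ (stageOrientation κ ν s R) o' =
      if o' = stageOrientation κ ν s (R \ {γ}) then 1 else 0 := by
  have hRs := hR.subset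
  have hγd := hRs hγ
  have hlt := H.compat_dd.1 γ hγd
  have hγV := (H.compat_dd.2.1 γ hγd).1
  have hRdiff : R \ {γ} ⊆ dd.cups := fun g hg => hRs hg.1
  set o := stageOrientation κ ν s R with ho
  set o₁ := stageOrientation κ ν s (R \ {γ}) with ho₁
  set S := SComp a e dd R (γ.1, s) with hS
  set T := SComp a e dd R (γ.1, !s) with hT
  set C := SComp a e dd (R \ {γ}) (γ.1, false) with hC
  have hSeq : S = {(γ.1, s), (γ.2, s)} := H.small_component hRs hγ
  have hCeq : C = S ∪ T := by
    rw [hC, H.merged_component hRs hγ, hS, hT]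
    cases s <;> simp [Set.union_comm]
  have hor : SOriented l0 a e dd R o := H.sOriented_stage hRs
  have hor₁ : SOriented l0 a e dd (R \ {γ}) o₁ := H.sOriented_stage hRdiff
  have htouch : ∀ p ∈ T, p.2 = s → Touches (dd.cups \ R) p.1 :=
    fun p hp => H.big_component_touches hRs hp
  have hTS : ∀ p ∈ T, p ∉ S := by
    intro p hp hpS
    rw [hSeq] at hpS
    have hps : p.2 = s := by rcases hpS with rfl | rfl <;> rfl
    obtain ⟨g, ⟨hg, hgR⟩, hend⟩ := htouch p hp hps
    refine hgR (H.compat_dd.eq_of_touch hg hγd hend ?_ ▸ hγ)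
    rcases hpS with rfl | rfl
    exacts [Or.inl rfl, Or.inr rfl]
  have hagree : ∀ p ∉ S, plab o p = plab o₁ p := fun p hp =>
    plab_stage_diff κ ν (hSeq ▸ hp)
  have hγT : ((γ.2, !s) : Pt) ∈ T := by
    refine SComp.closed SComp.self_mem ?_
    cases s <;> simp [SAdj, hγ]
  have hrightC : ∀ p, RightmostPt T p → RightmostPt C p := by
    intro p hp
    rw [hCeq]
    refine ⟨Or.inr hp.1, fun q hq => ?_⟩
    rcases hq with hq | hq
    · have := hp.2 _ hγT
      rw [hSeq] at hq
      rcases hq with rfl | rfl <;> simp only at this ⊢ <;> omega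
    · exact hp.2 q hq
  have hsame : ∀ p q, RightmostPt T p → RightmostPt C q → p.1 = q.1 := fun p q hp hq =>
    le_antisymm (hq.2 p (hrightC p hp).1) ((hrightC p hp).2 q hq.1)
  have hvert : ∀ p ∈ C, ∀ q ∈ C, p.1 = q.1 → plab o₁ p = plab o₁ q := by
    have key : ∀ x, ((x, s) : Pt) ∈ C → plab o₁ (x, s) = plab o₁ (x, !s) := by
      intro x hx
      have hnot : ¬ Touches (R \ {γ}) x := by
        rw [hCeq] at hx
        rcases hx with hx | hx
        · rw [hSeq] at hx
          rw [H.mem_iff_touches hRdiff hγd]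
          · simp
          · rcases hx with hx | hx
            exacts [Or.inl (congrArg Prod.fst hx), Or.inr (congrArg Prod.fst hx)]
        · obtain ⟨g, ⟨hg, hgR⟩, hend⟩ := htouch _ hx rfl
          rw [H.mem_iff_touches hRdiff hg hend]
          exact fun h => hgR h.1
      rw [ho₁, plab_stageOrientation, plab_stageOrientation]
      simp [hnot]
    rintro ⟨x, b⟩ hp ⟨y, b'⟩ hq hxy
    simp only at hxy
    subst hxy
    by_cases hb : b = s
    · subst hb
      by_cases hb' : b' = b
      · rw [hb']
      · rw [key x hp, Bool.eq_not.2 hb']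
    · by_cases hb' : b' = s
      · subst hb'
        rw [key x hq, Bool.eq_not.2 hb]
      · rw [Bool.eq_not.2 hb', Bool.eq_not.2 hb]
  have hsmallUp : IsAnticlockwise o S ∧ ¬ IsClockwise o S := by
    have hlab : plab o (γ.2, s) = Symb.up := by
      rw [ho, plab_stageOrientation, if_pos ⟨rfl, γ, hγ, Or.inr rfl⟩]
      exact (H.anticlockwise γ hγd).2
    constructor
    · refine ⟨(γ.2, s), ⟨by rw [hSeq]; simp, fun q hq => ?_⟩, hlab⟩
      rw [hSeq] at hq
      rcases hq with rfl | rfl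
      exacts [hlt.le, le_rfl]
    · rintro ⟨p, ⟨hp, hpm⟩, hdn⟩
      have hle := hpm (γ.2, s) (by rw [hSeq]; simp)
      rw [hSeq] at hp
      rcases hp with rfl | rfl
      · simp only at hle
        omega
      · rw [hlab] at hdn
        cases hdn
  obtain ⟨t, ht⟩ : ∃ t, RightmostPt T t := by
    obtain ⟨t, ht, hmax⟩ := Set.exists_max_image T Prod.fst (H.finite_component hRs hγV)
      ⟨_, hγT⟩
    exact ⟨t, ht, hmax⟩
  have htC := hrightC t ht
  have hbigLab : ∀ {p}, RightmostPt T p → plab o p = plab o₁ t := fun {p} hp =>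
    (hagree p (hTS p hp.1)).trans (hvert p (hrightC p hp).1 t htC.1
      (hsame p t hp htC))
  have htLab : plab o₁ t = Symb.up ∨ plab o₁ t = Symb.dn := by
    have htV : t.1 ∈ l0.vertices := H.component_subset_vertices hRs hγV ht.1
    rw [ho₁, plab_stageOrientation]
    split_ifs
    · exact (H.equiv_κ.vertices_eq ▸ htV : t.1 ∈ κ.vertices)
    · exact (H.equiv_ν.vertices_eq ▸ htV : t.1 ∈ ν.vertices)
  have hTup : IsAnticlockwise o T ↔ plab o₁ t = Symb.up :=
    ⟨fun ⟨p, hp, hup⟩ => (hbigLab hp).symm.trans hup, fun h => ⟨t, ht, (hbigLab ht).trans h⟩⟩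
  have hTdn : IsClockwise o T ↔ plab o₁ t = Symb.dn :=
    ⟨fun ⟨p, hp, hdn⟩ => (hbigLab hp).symm.trans hdn, fun h => ⟨t, ht, (hbigLab ht).trans h⟩⟩
  have hbase := H.base_eq_one hR hγ K rfl rfl
  have hrm : rmSign K l0 a e dd (R \ {γ}) T C = 1 := rmSign_eq_one K l0 hsame
  have hne : SComp a e dd R (γ.1, false) ≠ SComp a e dd R (γ.1, true) := by
    have hST : S ≠ T := fun h => hTS _ hγT (h ▸ hγT)
    rw [hS, hT] at hST
    cases s
    exacts [hST, hST.symm]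
  have hunion : SComp a e dd R (γ.1, false) ∪ SComp a e dd R (γ.1, true) = C :=
    (H.merged_component hRs hγ).symm
  have huniq : SOriented l0 a e dd (R \ {γ}) o' → (∀ p ∉ C, plab o p = plab o' p) →
      ∀ p ∈ C, plab o' p = plab o₁ p → o' = o₁ := by
    intro hor' hoff p hp hpe
    refine orientation_ext fun q => ?_
    by_cases hq : q ∈ C
    · exact hor'.agree_on_component hor₁ hp hq hpe
    · rw [← hoff q hq]
      exact hagree q fun hqS => hq (hCeq ▸ Or.inl hqS)
  have hclock : ∀ σ : Symb, plab o₁ t = σ → ∀ p, RightmostPt C p → plab o₁ p = σ :=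
    fun σ hσ p hp => (hvert p hp.1 t htC.1 (hsame t p ht hp).symm).trans hσ
  unfold stepCoeff
  simp only [hbase, hunion, if_pos hne]
  rw [← hC]
  by_cases hcond : ¬ SOriented l0 a e dd R o ∨ ¬ SOriented l0 a e dd (R \ {γ}) o' ∨
      ¬ (∀ p : Pt, p ∉ C → plab o p = plab o' p)
  · rw [if_pos hcond, if_neg]
    rintro rfl
    rcases hcond with h | h | h
    · exact h hor
    · exact h hor₁
    · exact h fun p hp => hagree p fun hpS => hp (hCeq ▸ Or.inl hpS)
  rw [if_neg hcond]
  have hor' : SOriented l0 a e dd (R \ {γ}) o' := by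
    by_contra h
    exact hcond (Or.inr (Or.inl h))
  have hoff : ∀ p ∉ C, plab o p = plab o' p := by
    by_contra h
    exact hcond (Or.inr (Or.inr h))
  have hacw : plab o₁ t = Symb.up → (IsAnticlockwise o' C ↔ o' = o₁) := by
    intro h
    constructor
    · rintro ⟨p, hp, hup⟩
      exact huniq hor' hoff p hp.1 (hup.trans (hclock _ h p hp).symm)
    · rintro rfl
      exact ⟨t, htC, h⟩
  have hcw : plab o₁ t = Symb.dn → (IsClockwise o' C ↔ o' = o₁) := by
    intro h
    constructor
    · rintro ⟨p, hp, hdn⟩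
      exact huniq hor' hoff p hp.1 (hdn.trans (hclock _ h p hp).symm)
    · rintro rfl
      exact ⟨t, htC, h⟩
  clear_value o₁
  rcases Bool.eq_false_or_eq_true s with rfl | rfl
  · rw [Bool.not_true] at hT
    rw [← hS, ← hT]
    rcases htLab with h | h
    · simp [hTup, hsmallUp, h, hacw h]
    · simp [hTup, hTdn, hsmallUp, h, hcw h, hrm]
  · rw [Bool.not_false] at hT
    rw [← hS, ← hT]
    rcases htLab with h | h
    · simp [hTup, hsmallUp, h, hacw h]
    · simp [hTup, hTdn, hsmallUp, h, hcw h, hrm]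

/-- Performing all surgeries replaces the labels of `κ` by those of `ν`. -/
theorem multAlong_eq (H : UnitSetup l0 κ ν a e dd s) (K : Type*) [Field K] :
    ∀ (L : List (ℤ × ℤ)) (R : Set (ℤ × ℤ)), IsStage dd R → IsLeftmostOrder L R →
      multAlong K l0 a e dd L R (fun o => if o = stageOrientation κ ν s R then 1 else 0) =
        fun o => if o = (ν, ν) then 1 else 0
  | [], R => by
      intro _ hL
      have hempty : R = ∅ := hL
      have : stageOrientation κ ν s R = (ν, ν) := by
        refine orientation_ext fun p => ?_
        rw [plab_stageOrientation, hempty]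
        simp [Touches, plab]
      simp only [multAlong, this]
  | γ :: L, R => by
      intro hR hL
      obtain ⟨hav, -, hL'⟩ := hL
      rw [multAlong, ← multAlong_eq H K L (R \ {γ}) (hR.diff hav) hL']
      congr 1
      funext o'
      rw [finsum_eq_single _ (stageOrientation κ ν s R)]
      · rw [if_pos rfl, mul_one, H.stepCoeff_eq hR hav.1 K o']
      · intro o ho
        rw [if_neg ho, mul_zero]

theorem stageOrientation_start (H : UnitSetup l0 κ ν a e dd s) :
    stageOrientation κ ν s dd.cups = if s then (ν, κ) else (κ, ν) := by
  have : mixedWeight κ ν dd.cups = κ := by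
    refine Weight.ext_lab fun i => ?_
    simp only [mixedWeight]
    split_ifs with h
    · rfl
    · rw [H.compat_dd.touches_iff H.rays_dd] at h
      rw [H.equiv_ν.lab_eq_of_notMem h, H.equiv_κ.lab_eq_of_notMem h]
  rw [stageOrientation, this]

theorem multAlong_basisInit (H : UnitSetup l0 κ ν a e dd s) (K : Type*) [Field K]
    {L : List (ℤ × ℤ)} (hL : IsLeftmostOrder L dd.cups) (o : Weight × Weight) :
    multAlong K l0 a e dd L dd.cups
      (basisInit K (if s then ν else κ) (if s then κ else ν)) o =
        if o = (ν, ν) then 1 else 0 := by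
  have hstage : IsStage dd dd.cups := ⟨subset_rfl, fun g hg hg' => absurd hg hg'⟩
  have hinit : basisInit K (if s then ν else κ) (if s then κ else ν) =
      fun o => if o = stageOrientation κ ν s dd.cups then 1 else 0 := by
    funext o
    rw [H.stageOrientation_start, basisInit]
    cases s <;> rfl
  rw [hinit, H.multAlong_eq K L dd.cups hstage hL]

end UnitSetup

theorem exists_isLeftmostOrder {R : Set (ℤ × ℤ)} (hR : R.Finite) :
    ∃ L, IsLeftmostOrder L R := by
  induction hn : R.ncard generalizing R with
  | zero => exact ⟨[], (Set.ncard_eq_zero hR).1 hn⟩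
  | succ n ih =>
    obtain ⟨γ, hγ, hmin⟩ := Set.exists_min_image R Prod.fst hR
      (Set.nonempty_of_ncard_ne_zero (by omega))
    obtain ⟨L, hL⟩ := ih (hR.sdiff (t := {γ})) (by
      rw [Set.ncard_sdiff_singleton_of_mem hγ]; omega)
    refine ⟨γ :: L, ⟨hγ, ?_⟩, fun γ' h => hmin γ' h.1, hL⟩
    rintro ⟨γ', h, -, hlt, -⟩
    exact absurd (hmin γ' h) (not_le.2 hlt)

theorem IsLowerDiagram.compat {c : CupDiagram} {l0 l : Weight} (h : IsLowerDiagram c l)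
    (hl : l0.Equiv l) : c.IsCompatible l0.vertices :=
  hl.vertices_eq ▸ h.1

theorem IsLowerDiagram.anticlockwise {c : CupDiagram} {l : Weight} (h : IsLowerDiagram c l) :
    ∀ g ∈ c.cups, l.lab g.1 = Symb.dn ∧ l.lab g.2 = Symb.up := by
  intro g hg
  have hfin := h.1.finite_cups l.finite_vertices
  have hempty := (Set.ncard_eq_zero (hfin.subset fun g hg => hg.1)).1 h.2.2
  rcases h.2.1.1 g hg with h' | h'
  · exact h'
  · have : g ∈ {p ∈ c.cups | l.lab p.2 = Symb.dn} := ⟨hg, h'.2⟩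
    rw [hempty] at this
    exact this.elim

theorem BKBasis.ext_weights {l0 : Weight} {b b' : BKBasis l0} (h1 : b.1.1 = b'.1.1)
    (h2 : b.1.2.1 = b'.1.2.1) (h3 : b.1.2.2 = b'.1.2.2) : b = b' :=
  Subtype.ext (Prod.ext h1 (Prod.ext h2 h3))

theorem MultSpec.idempotent_mul {K : Type*} [Field K] {l0 : Weight}
    {mult : BKA K l0 → BKA K l0 → BKA K l0} (hmult : MultSpec K l0 mult) {lam : Weight}
    (hl : ValidTriple l0 (lam, lam, lam)) (b : BKBasis l0) (hb : b.1.1 = lam) :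
    mult (Finsupp.single ⟨(lam, lam, lam), hl⟩ 1) (Finsupp.single b 1) =
      Finsupp.single b 1 := by
  subst hb
  obtain ⟨-, hν, hη, ⟨c, hc, hcr⟩, ⟨e, he, her⟩, hcν, heν⟩ := id b.2
  have H : UnitSetup l0 b.1.1 b.1.2.1 c e c false :=
    ⟨Or.inl ⟨rfl, rfl⟩, hc.compat hl.1, he.compat hη, hc.compat hl.1, hcr, hl.1, hν,
      (hcν c hc).1, (heν e he).1, hc.anticlockwise⟩
  obtain ⟨L, hL⟩ := exists_isLeftmostOrder (H.compat_dd.finite_cups l0.finite_vertices)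
  refine Finsupp.ext fun b' => ?_
  refine (hmult.2.2.2.2.2 ⟨_, hl⟩ b rfl c c e L hc hcr hc hcr he her hL b').trans ?_
  have hmain := H.multAlong_basisInit K hL (b'.1.2.1, b'.1.2.1)
  simp only [Bool.false_eq_true, if_false] at hmain
  simp only [hmain, Finsupp.single_apply]
  simp only [Prod.mk.injEq, and_self, ← ite_and]
  refine if_congr ?_ rfl rfl
  constructor
  · rintro ⟨⟨h1, h2⟩, h3⟩
    exact BKBasis.ext_weights h1.symm h3.symm h2.symm
  · rintro rfl
    exact ⟨⟨rfl, rfl⟩, rfl⟩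

theorem MultSpec.mul_idempotent {K : Type*} [Field K] {l0 : Weight}
    {mult : BKA K l0 → BKA K l0 → BKA K l0} (hmult : MultSpec K l0 mult) {mu : Weight}
    (hm : ValidTriple l0 (mu, mu, mu)) (b : BKBasis l0) (hb : b.1.2.2 = mu) :
    mult (Finsupp.single b 1) (Finsupp.single ⟨(mu, mu, mu), hm⟩ 1) =
      Finsupp.single b 1 := by
  subst hb
  obtain ⟨hlam, hν, -, ⟨a, ha, har⟩, ⟨c, hc, hcr⟩, haν, hcν⟩ := id b.2
  have H : UnitSetup l0 b.1.2.2 b.1.2.1 a c c true :=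
    ⟨Or.inr ⟨rfl, rfl⟩, ha.compat hlam, hc.compat hm.1, hc.compat hm.1, hcr, hm.1, hν,
      (haν a ha).1, (hcν c hc).1, hc.anticlockwise⟩
  obtain ⟨L, hL⟩ := exists_isLeftmostOrder (H.compat_dd.finite_cups l0.finite_vertices)
  refine Finsupp.ext fun b' => ?_
  refine (hmult.2.2.2.2.2 b ⟨_, hm⟩ rfl a c c L ha har hc hcr hc hcr hL b').trans ?_
  have hmain := H.multAlong_basisInit K hL (b'.1.2.1, b'.1.2.1)
  simp only [if_true] at hmain
  simp only [hmain, Finsupp.single_apply]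
  simp only [Prod.mk.injEq, and_self, ← ite_and]
  refine if_congr ?_ rfl rfl
  constructor
  · rintro ⟨⟨h1, h2⟩, h3⟩
    exact BKBasis.ext_weights h1.symm h3.symm h2.symm
  · rintro rfl
    exact ⟨⟨rfl, rfl⟩, rfl⟩

/-- The elements `1_λ = underline λ λ overline λ` for `λ ∈ Λ°` are pairwise orthogonal
idempotents of the Blanchet–Khovanov algebra, and they act as local units:
`mult(1_λ ⊗ 1_λ) = 1_λ`, `mult(1_λ ⊗ 1_μ) = 0` for `λ ≠ μ`, and for every basis vector
`x = underline λ ν overline μ` one has `mult(1_λ ⊗ x) = x = mult(x ⊗ 1_μ)`.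
Hence `1 = Σ_{λ ∈ Λ°} 1_λ` is a unit for `A^F_Λ`. -/
theorem idempotents_of_BK_algebra (K : Type*) [Field K] (l0 : Weight)
    (hbal : l0.Balanced)
    (mult : BKA K l0 → BKA K l0 → BKA K l0) (hmult : MultSpec K l0 mult) :
    ∀ (lam mu : Weight) (hl : ValidTriple l0 (lam, lam, lam))
      (hm : ValidTriple l0 (mu, mu, mu)),
      mult (Finsupp.single ⟨(lam, lam, lam), hl⟩ 1) (Finsupp.single ⟨(lam, lam, lam), hl⟩ 1) =
          Finsupp.single ⟨(lam, lam, lam), hl⟩ 1 ∧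
      (lam ≠ mu →
        mult (Finsupp.single ⟨(lam, lam, lam), hl⟩ 1)
            (Finsupp.single ⟨(mu, mu, mu), hm⟩ 1) = 0) ∧
      (∀ b : BKBasis l0,
        (b.1.1 = lam →
          mult (Finsupp.single ⟨(lam, lam, lam), hl⟩ 1) (Finsupp.single b 1) =
            Finsupp.single b 1) ∧
        (b.1.2.2 = mu →
          mult (Finsupp.single b 1) (Finsupp.single ⟨(mu, mu, mu), hm⟩ 1) =
            Finsupp.single b 1)) := by
  intro lam mu hl hm
  exact ⟨hmult.idempotent_mul hl _ rfl, fun hne => hmult.2.2.2.2.1 _ _ hne,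
    fun b => ⟨hmult.idempotent_mul hl b, hmult.mul_idempotent hm b⟩⟩

end BK
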